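/- Let H ∈ M_d(ℂ) be Hermitian and assume all the C_i are diagonal in the orthonormal basis P. Let α ≠ β in P and set |α+β⟩ = (|α⟩ + |β⟩)/√2 and |α+iβ⟩ = (|α⟩ + i|β⟩)/√2. Then (L(|α+β⟩⟨α+β|))_{αα} = Im(H_{αβ}) and (L(|α+iβ⟩⟨α+iβ|))_{αα} = Re(H_{αβ}). Consequently, if both of these diagonal entries vanish, then H_{αβ} = 0. -/

import Mathlib

open Matrix

/-- A dissipator whose jump operators are all diagonal has vanishing diagonal entries. -/
theorem dissipator_diagonal_apply_self {ι m : Type*} [Fintype ι] [Fintype m] [DecidableEq m]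
    (c : ι → m → ℂ) (ρ : Matrix m m ℂ) (a : m) :
    (∑ i, (diagonal (c i) * ρ * (diagonal (c i))ᴴ
      - ((1 : ℂ) / 2) • ((diagonal (c i))ᴴ * diagonal (c i) * ρ
        + ρ * ((diagonal (c i))ᴴ * diagonal (c i))))) a a = 0 := by
  rw [Matrix.sum_apply]
  refine Finset.sum_eq_zero fun i _ => ?_
  simp only [diagonal_conjTranspose, diagonal_mul_diagonal, Matrix.sub_apply,
    Matrix.smul_apply, Matrix.add_apply, diagonal_mul, mul_diagonal, smul_eq_mul, Pi.star_apply]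
  ring

/-- The diagonal entry at `a` of `-i[H, |v⟩⟨v|]` for `v = (|a⟩ + z|b⟩)/√2` is `Im (z H_{ab})`. -/
theorem commutator_superposition_apply_self {m : Type*} [Fintype m] [DecidableEq m]
    {H : Matrix m m ℂ} (hH : H.IsHermitian) {a b : m} (hab : a ≠ b) (z : ℂ) {v : m → ℂ}
    (hv : v = ((Real.sqrt 2 : ℂ))⁻¹ • (Pi.single a (1 : ℂ) + z • (Pi.single b (1 : ℂ) : m → ℂ))) :
    ((-Complex.I) • (H * vecMulVec v (star v) - vecMulVec v (star v) * H)) a a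
      = ((z * H a b).im : ℂ) := by
  have hs : ((Real.sqrt 2 : ℂ))⁻¹ * ((Real.sqrt 2 : ℂ))⁻¹ = 1 / 2 := by
    rw [← mul_inv, ← Complex.ofReal_mul, Real.mul_self_sqrt zero_le_two]
    norm_num
  have hva : v a = ((Real.sqrt 2 : ℂ))⁻¹ := by simp [hv, hab]
  have hHv : (H *ᵥ v) a = ((Real.sqrt 2 : ℂ))⁻¹ * (H a a + z * H a b) := by
    simp [hv, mulVec_smul, mulVec_add, mul_add]
  have hvH : (star v ᵥ* H) a = star ((H *ᵥ v) a) := by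
    rw [← Pi.star_apply, star_mulVec, hH.eq]
  have hdiag : star (H a a) = H a a := hH.apply a a
  have him := Complex.sub_conj (z * H a b)
  rw [Matrix.smul_apply, Matrix.sub_apply, mul_vecMulVec, vecMulVec_mul, vecMulVec_apply,
    vecMulVec_apply, hvH, hHv, Pi.star_apply, hva]
  simp only [star_mul', star_add, hdiag, star_inv₀, Complex.star_def, Complex.conj_ofReal,
    smul_eq_mul] at him ⊢
  simp only [map_mul] at him
  push_cast at him
  linear_combination (-Complex.I * (z * H a b - (starRingEnd ℂ) z * (starRingEnd ℂ) (H a b))) * hs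
    - Complex.I / 2 * him - ((z * H a b).im : ℂ) * Complex.I_mul_I

/-- If `H` is Hermitian and all the `C_i = diagonal (c i)` in the
orthonormal basis `P` (the basis in which entries are taken), then for distinct
`α ≠ β`, with `|α+β⟩ = (|α⟩+|β⟩)/√2` and `|α+iβ⟩ = (|α⟩+i|β⟩)/√2`,
`(L(|α+β⟩⟨α+β|))_{αα} = Im H_{αβ}` and `(L(|α+iβ⟩⟨α+iβ|))_{αα} = Re H_{αβ}`;
consequently if both vanish then `H_{αβ} = 0`. -/
theorem lindblad_superposition_entries (d n : ℕ) (hd : 1 ≤ d)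
    (c : Fin (n + 1) → Fin d → ℂ)
    (H : Matrix (Fin d) (Fin d) ℂ) (hH : H.IsHermitian)
    (C : Fin (n + 1) → Matrix (Fin d) (Fin d) ℂ)
    (hC : ∀ i, C i = Matrix.diagonal (c i))
    (α β : Fin d) (hαβ : α ≠ β)
    (v₁ v₂ : Fin d → ℂ)
    (hv₁ : v₁ = ((Real.sqrt 2 : ℂ))⁻¹ • (Pi.single α (1 : ℂ) + Pi.single β (1 : ℂ)))
    (hv₂ : v₂ = ((Real.sqrt 2 : ℂ))⁻¹ •
        (Pi.single α (1 : ℂ) + Complex.I • (Pi.single β (1 : ℂ) : Fin d → ℂ)))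
    (ρ₁ ρ₂ : Matrix (Fin d) (Fin d) ℂ)
    (hρ₁ : ρ₁ = Matrix.vecMulVec v₁ (star v₁))
    (hρ₂ : ρ₂ = Matrix.vecMulVec v₂ (star v₂)) :
    ((-Complex.I) • (H * ρ₁ - ρ₁ * H)
        + ∑ i : Fin (n + 1),
            (C i * ρ₁ * (C i)ᴴ
              - ((1 : ℂ) / 2) • ((C i)ᴴ * C i * ρ₁ + ρ₁ * ((C i)ᴴ * C i)))) α α
      = ((H α β).im : ℂ)
    ∧ ((-Complex.I) • (H * ρ₂ - ρ₂ * H)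
        + ∑ i : Fin (n + 1),
            (C i * ρ₂ * (C i)ᴴ
              - ((1 : ℂ) / 2) • ((C i)ᴴ * C i * ρ₂ + ρ₂ * ((C i)ᴴ * C i)))) α α
      = ((H α β).re : ℂ)
    ∧ (((-Complex.I) • (H * ρ₁ - ρ₁ * H)
        + ∑ i : Fin (n + 1),
            (C i * ρ₁ * (C i)ᴴ
              - ((1 : ℂ) / 2) • ((C i)ᴴ * C i * ρ₁ + ρ₁ * ((C i)ᴴ * C i)))) α α = 0 →
       ((-Complex.I) • (H * ρ₂ - ρ₂ * H)
        + ∑ i : Fin (n + 1),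
            (C i * ρ₂ * (C i)ᴴ
              - ((1 : ℂ) / 2) • ((C i)ᴴ * C i * ρ₂ + ρ₂ * ((C i)ᴴ * C i)))) α α = 0 →
       H α β = 0) := by
  have hdiss := fun ρ => dissipator_diagonal_apply_self c ρ α
  have h₁ := commutator_superposition_apply_self hH hαβ 1 (v := v₁) (by rw [hv₁, one_smul])
  have h₂ := commutator_superposition_apply_self hH hαβ Complex.I hv₂
  rw [one_mul] at h₁
  rw [Complex.I_mul_im] at h₂
  subst hρ₁ hρ₂
  simp only [hC]
  rw [Matrix.add_apply, Matrix.add_apply, hdiss, hdiss, add_zero, add_zero, h₁, h₂]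
  refine ⟨rfl, rfl, fun him hre => Complex.ext ?_ ?_⟩
  · exact_mod_cast hre
  · exact_mod_cast him
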